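/- Let p be a sock sequence and let x be a sock that is clumped in p (all occurrences of x in p are consecutive). Then x is clumped in φ_{aba}(p). -/

import Mathlib

attribute [local instance] Classical.propDecidable

/-- Two lists have the same shape: same length and identical equality pattern
of entries (`q_i = q_j` iff `r_i = r_j`). -/
def SameShape {A : Type*} {B : Type*} (q : List A) (r : List B) : Prop :=
  q.length = r.length ∧ ∀ i j : ℕ, (q[i]? = q[j]? ↔ r[i]? = r[j]?)

/-- `ContainsPat p σ` : the sock sequence `p` contains the pattern `σ`
(not necessarily consecutively): there are indices `i_1 < ⋯ < i_m` such that
`p_{i_j} = p_{i_k} ↔ σ_j = σ_k`. -/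
def ContainsPat {A : Type*} {B : Type*} (p : List A) (σ : List B) : Prop :=
  ∃ q : List A, q.Sublist p ∧ SameShape q σ

/-- A sock sequence is sorted if all occurrences of each sock appear
consecutively. -/
def SortedSocks {A : Type*} (p : List A) : Prop :=
  ∀ i j k : ℕ, i ≤ j → j ≤ k → p[i]? = p[k]? → p[j]? = p[i]?

/-- One pass of the deterministic σ-avoiding stack-sorting procedure:
`sortAux σ input stack` runs the σ-avoiding stack with the given remaining
input and current stack (stack listed from top to bottom), returning the rest
of the output.  If input remains and pushing the next input sock onto the
stack does not create a σ-pattern in the stack, that sock is pushed; otherwise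
the top sock of the stack is popped to the output. -/
noncomputable def sortAux {A : Type*} {B : Type*} (σ : List B) : List A → List A → List A
  | [], stack => stack
  | x :: input, stack =>
    if ContainsPat (x :: stack) σ then
      match stack with
      | [] => sortAux σ input [x]
      | t :: rest => t :: sortAux σ (x :: input) rest
    else
      sortAux σ input (x :: stack)
termination_by input stack => 2 * input.length + stack.length
decreasing_by all_goals simp only [List.length_cons]; omega

/-- The deterministic σ-avoiding stack-sorting map `φ_σ`. -/
noncomputable def phi {A : Type*} {B : Type*} (σ : List B) (p : List A) : List A :=
  sortAux σ p []

/-- The pattern `aba`: first and third socks equal, distinct from the second. -/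
def abaPat : List ℕ := [0, 1, 0]

/-- A sock `x` is clumped in a sock sequence `p` if all occurrences of `x` in
`p` are consecutive. -/
def Clumped {A : Type*} (x : A) (p : List A) : Prop :=
  ∀ i j k : ℕ, i ≤ j → j ≤ k → p[i]? = some x → p[k]? = some x → p[j]? = some x

theorem containsPat_abaPat_iff {A : Type*} {l : List A} :
    ContainsPat l abaPat ↔ ∃ a b : A, a ≠ b ∧ [a, b, a].Sublist l := by
  constructor
  · rintro ⟨q, hq, hlen, hsame⟩
    obtain ⟨a, b, c, rfl⟩ := List.length_eq_three.1 (show q.length = 3 from hlen)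
    have hac := (hsame 0 2).2 rfl
    have hab := hsame 0 1
    simp [abaPat] at hac hab
    subst hac
    exact ⟨a, b, hab, hq⟩
  · rintro ⟨a, b, hab, h⟩
    refine ⟨_, h, rfl, fun i j => ?_⟩
    rcases i with _ | _ | _ | i <;> rcases j with _ | _ | _ | j <;>
      simp [abaPat, hab, hab.symm]

theorem ContainsPat.mono {A B : Type*} {l m : List A} {σ : List B}
    (h : ContainsPat l σ) (hlm : l.Sublist m) : ContainsPat m σ :=
  let ⟨q, hq, hs⟩ := h
  ⟨q, hq.trans hlm, hs⟩

/-- A sock whose push creates a new `aba` already occurs below the top of the stack, under a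
different sock. -/
theorem exists_sublist_of_containsPat_cons {A : Type*} {y : A} {s : List A}
    (h : ContainsPat (y :: s) abaPat) (hs : ¬ ContainsPat s abaPat) :
    ∃ b, y ≠ b ∧ [b, y].Sublist s := by
  obtain ⟨a, b, hab, h⟩ := containsPat_abaPat_iff.1 h
  cases h with
  | cons _ h => exact absurd (containsPat_abaPat_iff.2 ⟨a, b, hab, h⟩) hs
  | cons_cons _ h => exact ⟨b, hab, h⟩

theorem containsPat_cons_of_mem {A : Type*} {y t : A} {s : List A} (hyt : y ≠ t) (h : y ∈ s) :
    ContainsPat (y :: t :: s) abaPat :=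
  containsPat_abaPat_iff.2 ⟨y, t, hyt, by simpa using h⟩

theorem sortAux_push {A B : Type*} {σ : List B} {y : A} {l s : List A}
    (h : ¬ ContainsPat (y :: s) σ) : sortAux σ (y :: l) s = sortAux σ l (y :: s) := by
  rw [sortAux.eq_def]
  exact if_neg h

theorem sortAux_pop {A B : Type*} {σ : List B} {y t : A} {l s : List A}
    (h : ContainsPat (y :: t :: s) σ) :
    sortAux σ (y :: l) (t :: s) = t :: sortAux σ (y :: l) s := by
  rw [sortAux, if_pos h]

theorem mem_of_mem_sortAux {A B : Type*} {σ : List B} {x : A} {l s : List A}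
    (h : x ∈ sortAux σ l s) : x ∈ l ∨ x ∈ s := by
  fun_induction sortAux σ l s <;> grind

/-- All copies of `x` in `l` form a single block. -/
def IsBlock {A : Type*} (x : A) (l : List A) : Prop :=
  ∃ (u : List A) (k : ℕ) (v : List A), l = u ++ List.replicate k x ++ v ∧ x ∉ u ∧ x ∉ v

theorem IsBlock.of_notMem {A : Type*} {x : A} {l : List A} (h : x ∉ l) : IsBlock x l :=
  ⟨l, 0, [], by simp, h, by simp⟩

theorem IsBlock.cons_of_ne {A : Type*} {x t : A} {l : List A} (h : IsBlock x l) (ht : x ≠ t) :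
    IsBlock x (t :: l) := by
  obtain ⟨u, k, v, rfl, hu, hv⟩ := h
  exact ⟨t :: u, k, v, by simp, by simp [ht, hu], hv⟩

theorem IsBlock.clumped {A : Type*} {x : A} {l : List A} (h : IsBlock x l) : Clumped x l := by
  obtain ⟨u, k, v, rfl, hu, hv⟩ := h
  have key : ∀ i, (u ++ List.replicate k x ++ v)[i]? = some x ↔
      u.length ≤ i ∧ i < u.length + k := by
    intro i
    rw [List.append_assoc, List.getElem?_append]
    split_ifs with h₁
    · have : u[i]? ≠ some x := fun h => hu (List.mem_of_getElem? h)
      simp only [this, false_iff]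
      omega
    · rw [List.getElem?_append]
      split_ifs with h₂
      · rw [List.length_replicate] at h₂
        rw [List.getElem?_replicate, if_pos h₂]
        simp only [true_iff]
        omega
      · have : v[i - u.length - (List.replicate k x).length]? ≠ some x :=
          fun h => hv (List.mem_of_getElem? h)
        simp only [this, false_iff]
        rw [List.length_replicate] at h₂
        omega
  intro i j k hij hjk hi hk
  rw [key] at *
  omega

theorem Clumped.isBlock {A : Type*} {x : A} {l : List A} (h : Clumped x l) : IsBlock x l := by
  induction l with
  | nil => exact .of_notMem (by simp)
  | cons t l ih =>
    have hl : IsBlock x l := ih fun i j k hij hjk hi hk => by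
      simpa using h (i + 1) (j + 1) (k + 1) (by omega) (by omega) (by simpa) (by simpa)
    by_cases ht : x = t
    · subst ht
      by_cases hx : x ∈ l
      · obtain ⟨u, k, v, rfl, hu, hv⟩ := hl
        cases u with
        | nil => exact ⟨[], k + 1, v, by simp [List.replicate_succ], by simp, hv⟩
        | cons c u =>
          obtain ⟨n, hn⟩ := List.mem_iff_getElem?.1 hx
          have := h 0 1 (n + 1) (by omega) (by omega) (by simp) (by simpa using hn)
          simp at this
          simp [this] at hu
      · exact ⟨[], 1, l, by simp, by simp, hx⟩
    · exact hl.cons_of_ne ht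

theorem sortAux_replicate_append {A : Type*} {x y : A} {l v : List A} (hxy : y ≠ x) (hy : y ∈ v)
    (k : ℕ) : sortAux abaPat (y :: l) (List.replicate k x ++ v) =
      List.replicate k x ++ sortAux abaPat (y :: l) v := by
  induction k with
  | zero => simp
  | succ k ih =>
    rw [List.replicate_succ, List.cons_append,
      sortAux_pop (containsPat_cons_of_mem hxy (by simp [hy])), ih, List.cons_append]

/-- Once all copies of `x` have been read, a block of `x` in the stack leaves it as a block. -/
theorem isBlock_sortAux_of_stack {A : Type*} {x : A} (l s : List A) (hl : x ∉ l)
    (hs : ¬ ContainsPat s abaPat) (hb : IsBlock x s) : IsBlock x (sortAux abaPat l s) := by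
  fun_induction sortAux abaPat l s with
  | case1 s => exact hb
  | case2 y l hc ih =>
    obtain ⟨b, _, h⟩ := exists_sublist_of_containsPat_cons hc hs
    simp at h
  | case3 y l t r hc ih =>
    by_cases ht : x = t
    · subst ht
      obtain ⟨u, k, v, he, hu, hv⟩ := hb
      have hyx : y ≠ x := fun h => hl (by simp [h])
      obtain ⟨b, _, h⟩ := exists_sublist_of_containsPat_cons hc hs
      have hy : y ∈ x :: r := h.subset (by simp)
      cases u with
      | cons c u => simp at he; simp [he.1] at hu
      | nil =>
        rw [List.nil_append] at he
        rw [he] at hy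
        have hyv : y ∈ v := by simpa [hyx] using hy
        rw [← sortAux_pop hc, he, sortAux_replicate_append hyx hyv]
        exact ⟨[], k, sortAux abaPat (y :: l) v, by simp, by simp, fun h => (mem_of_mem_sortAux h).elim hl hv⟩
    · refine (ih hl (fun h => hs (h.mono (List.sublist_cons_self _ _))) ?_).cons_of_ne ht
      obtain ⟨u, k, v, he, hu, hv⟩ := hb
      cases u with
      | cons c u =>
        simp only [List.cons_append, List.cons.injEq] at he
        exact ⟨u, k, v, he.2, fun h => hu (by simp [h]), hv⟩
      | nil =>
        cases k with
        | zero =>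
          simp at he
          exact .of_notMem fun h => hv (by simp [← he, h])
        | succ k => simp [List.replicate_succ] at he; exact absurd he.1.symm ht
  | case4 y l s hc ih =>
    exact ih (fun h => hl (by simp [h])) hc (hb.cons_of_ne fun h => hl (by simp [h]))

/-- While a block of `x` is being read, it is pushed onto the stack without interruption. -/
theorem sortAux_replicate_input {A : Type*} {x : A} {b v : List A} (hv : x ∉ v) (m k : ℕ)
    (hs : ¬ ContainsPat (List.replicate k x ++ v) abaPat) :
    ∃ n, ¬ ContainsPat (List.replicate n x ++ v) abaPat ∧
      sortAux abaPat (List.replicate m x ++ b) (List.replicate k x ++ v) =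
        sortAux abaPat b (List.replicate n x ++ v) := by
  induction m generalizing k with
  | zero => exact ⟨k, hs, by simp⟩
  | succ m ih =>
    have hc : ¬ ContainsPat (x :: (List.replicate k x ++ v)) abaPat := by
      intro hc
      obtain ⟨c, hxc, h⟩ := exists_sublist_of_containsPat_cons hc hs
      clear hs hc
      induction k with
      | zero => exact hv (h.subset (by simp))
      | succ k ihk =>
        rw [List.replicate_succ, List.cons_append] at h
        cases h with
        | cons _ h => exact ihk h
        | cons_cons _ h => exact hxc rfl
    obtain ⟨n, hn, he⟩ := ih (k + 1) hc
    refine ⟨n, hn, ?_⟩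
    rw [List.replicate_succ, List.cons_append, sortAux_push hc, ← he]
    rfl

theorem isBlock_sortAux_of_input {A : Type*} {x : A} (l s : List A) (hx : x ∉ s)
    (hs : ¬ ContainsPat s abaPat) (hb : IsBlock x l) : IsBlock x (sortAux abaPat l s) := by
  obtain ⟨u, m, b, rfl, hu, hb⟩ := hb
  induction u generalizing s with
  | nil =>
    obtain ⟨n, hn, he⟩ := sortAux_replicate_input (b := b) hx m 0 hs
    simp only [List.replicate_zero, List.nil_append] at he ⊢
    rw [he]
    exact isBlock_sortAux_of_stack _ _ hb hn ⟨[], n, s, by simp, by simp, hx⟩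
  | cons y u ih =>
    have hyx : x ≠ y := fun h => hu (by simp [h])
    induction s with
    | nil =>
      have hc : ¬ ContainsPat [y] abaPat := fun h => by
        obtain ⟨c, _, h⟩ := exists_sublist_of_containsPat_cons h hs
        simp at h
      simp only [List.cons_append]
      rw [sortAux_push hc]
      exact ih [y] (by simp [hyx]) hc (fun h => hu (by simp [h]))
    | cons t s ihs =>
      by_cases hc : ContainsPat (y :: t :: s) abaPat
      · simp only [List.cons_append] at ihs ⊢
        rw [sortAux_pop hc]
        exact (ihs (fun h => hx (by simp [h]))
          (fun h => hs (h.mono (List.sublist_cons_self _ _)))).cons_of_ne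
          fun h => hx (by simp [h])
      · simp only [List.cons_append]
        rw [sortAux_push hc]
        refine ih (y :: t :: s) ?_ hc (fun h => hu (by simp [h]))
        rw [List.mem_cons, not_or]
        exact ⟨hyx, hx⟩

/-- If a sock `x` is clumped in `p`, then `x` is clumped in `φ_{aba}(p)`. -/
theorem clumped_phi_aba {A : Type*} (p : List A) (x : A) (hx : Clumped x p) :
    Clumped x (phi abaPat p) := by
  refine (isBlock_sortAux_of_input p [] (by simp) (fun h => ?_) hx.isBlock).clumped
  obtain ⟨a, b, _, h⟩ := containsPat_abaPat_iff.1 h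
  simp at h
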